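/- arXiv:2502.18419 — 2 statements merged into one kernel-verified Lean document; each statement's English description precedes it below -/
import Mathlib

section
/- Let 1 ≤ m ≤ n be integers and let (ℐ, (I_α, J_α)_{α∈ℐ}, (c_α)_{α∈ℐ}) be a quadratic expression over Gr(m,m+n). Because the multiset unions I_α ⊎ J_α coincide, the set (I_α ∖ J_α) ∪ (J_α ∖ I_α) and the number η := |I_α ∖ J_α| do not depend on α; assume η ≥ 1, let Φ be the unique order-preserving bijection from (I_α ∖ J_α) ∪ (J_α ∖ I_α) onto {1,…,2η}, and set K_α := Φ(I_α ∖ J_α) and L_α := Φ(J_α ∖ I_α). Then ∑_{α∈ℐ} c_α Δ_{I_α}(𝒜) Δ_{J_α}(𝒜) ≥ 0 for every full-rank (m+n)×m real matrix 𝒜 with all Plücker coordinates nonnegative if and only if ∑_{α∈ℐ} c_α Δ_{K_α}(ℬ) Δ_{L_α}(ℬ) ≥ 0 for every full-rank 2η×η real matrix ℬ with all Plücker coordinates nonnegative. -/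
open Finset

/-- The Plücker coordinate `Δ_I(A)`: the determinant of the `m × m` submatrix of `A`
whose rows are indexed by `I` in increasing order (and all `m` columns);
junk value `0` when `I` does not have `m` elements. -/
noncomputable def pluck {N m : ℕ} (A : Matrix (Fin N) (Fin m) ℝ) (I : Finset (Fin N)) : ℝ :=
  if h : I.card = m then (A.submatrix (fun k => ((I.orderIsoOfFin h) k : Fin N)) id).det else 0

theorem pluck_of_card_eq {N m : ℕ} (A : Matrix (Fin N) (Fin m) ℝ) {I : Finset (Fin N)}
    (h : I.card = m) : pluck A I = (A.submatrix (I.orderEmbOfFin h) id).det := by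
  rw [pluck, dif_pos h]
  rfl

theorem pluck_of_card_ne {N m : ℕ} (A : Matrix (Fin N) (Fin m) ℝ) {I : Finset (Fin N)}
    (h : I.card ≠ m) : pluck A I = 0 := dif_neg h

theorem card_eq_of_pluck_ne_zero {N m : ℕ} {A : Matrix (Fin N) (Fin m) ℝ} {I : Finset (Fin N)}
    (h : pluck A I ≠ 0) : I.card = m :=
  not_imp_comm.1 (pluck_of_card_ne A) h

theorem rank_eq_of_pluck_ne_zero {N m : ℕ} {A : Matrix (Fin N) (Fin m) ℝ} {I : Finset (Fin N)}
    (h : pluck A I ≠ 0) : A.rank = m := by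
  have hI := card_eq_of_pluck_ne_zero h
  rw [pluck_of_card_eq A hI] at h
  refine le_antisymm A.rank_le_width ?_
  have h1 := A.rank_submatrix_le (I.orderEmbOfFin hI) id
  rwa [Matrix.rank_of_isUnit _ ((Matrix.isUnit_iff_isUnit_det _).2 h.isUnit),
    Fintype.card_fin] at h1

theorem pluck_mul {N m : ℕ} (A : Matrix (Fin N) (Fin m) ℝ) (G : Matrix (Fin m) (Fin m) ℝ)
    (I : Finset (Fin N)) : pluck (A * G) I = pluck A I * G.det := by
  by_cases h : I.card = m
  · rw [pluck_of_card_eq _ h, pluck_of_card_eq _ h, ← Matrix.det_mul]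
    rfl
  · simp [pluck_of_card_ne _ h]

theorem pluck_zero {N m : ℕ} (hm : 1 ≤ m) (I : Finset (Fin N)) :
    pluck (0 : Matrix (Fin N) (Fin m) ℝ) I = 0 := by
  by_cases h : I.card = m
  · rw [pluck_of_card_eq _ h, Matrix.submatrix_zero]
    have : Nonempty (Fin m) := ⟨⟨0, hm⟩⟩
    exact Matrix.det_zero
  · exact pluck_of_card_ne _ h

/-- The sign `(-1) ^ #{c ∈ C | k ≤ c}`. -/
noncomputable def gapSign {N : ℕ} (C : Finset (Fin N)) (k : Fin N) : ℝ :=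
  ∏ c ∈ C, if c < k then 1 else -1

theorem gapSign_mul_self {N : ℕ} (C : Finset (Fin N)) (k : Fin N) :
    gapSign C k * gapSign C k = 1 := by
  rw [gapSign, ← prod_mul_distrib]
  exact prod_eq_one fun c _ => by split_ifs <;> norm_num

theorem castAdd_lt_natAdd {p q : ℕ} (i : Fin p) (j : Fin q) :
    Fin.castAdd q i < Fin.natAdd p j := by
  simp only [Fin.lt_def, Fin.val_castAdd, Fin.val_natAdd]
  omega

theorem prod_orderEmbOfFin {N q : ℕ} {K : Finset (Fin N)} (hK : K.card = q) (f : Fin N → ℝ) :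
    ∏ j, f (K.orderEmbOfFin hK j) = ∏ k ∈ K, f k := by
  conv_rhs => rw [← K.map_orderEmbOfFin_univ hK, prod_map]
  rfl

/-- Listing the rows of `C` before those of `K` changes the minor by a product of signs. -/
theorem det_submatrix_append {N p q : ℕ} (A : Matrix (Fin N) (Fin (p + q)) ℝ)
    {C K : Finset (Fin N)} (hC : C.card = p) (hK : K.card = q) (hCK : Disjoint C K) :
    (A.submatrix (Fin.append (C.orderEmbOfFin hC) (K.orderEmbOfFin hK)) id).det =
      (∏ k ∈ K, gapSign C k) * pluck A (C ∪ K) := by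
  have hU : (C ∪ K).card = p + q := by rw [card_union_of_disjoint hCK, hC, hK]
  set f := Fin.append (C.orderEmbOfFin hC) (K.orderEmbOfFin hK) with hf
  have hfmem : ∀ i, f i ∈ C ∪ K := by
    intro i
    refine Fin.addCases (fun i => ?_) (fun i => ?_) i
    · simp [hf]
    · simp [hf]
  have hfinj : Function.Injective f := by
    rw [hf, Fin.append_injective_iff]
    exact ⟨(C.orderEmbOfFin hC).injective, (K.orderEmbOfFin hK).injective, fun i j =>
      disjoint_iff_ne.1 hCK _ (orderEmbOfFin_mem C hC i) _ (orderEmbOfFin_mem K hK j)⟩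
  let s : Fin (p + q) → Fin (p + q) := fun i => ((C ∪ K).orderIsoOfFin hU).symm ⟨f i, hfmem i⟩
  have hs : Function.Injective s := fun i j h => hfinj (by simpa [s] using h)
  let σ : Equiv.Perm (Fin (p + q)) := Equiv.ofBijective s (Finite.injective_iff_bijective.1 hs)
  have hσ : ∀ i, (C ∪ K).orderEmbOfFin hU (σ i) = f i := by
    intro i
    rw [← coe_orderIsoOfFin_apply]
    simp [σ, s]
  have hlt : ∀ i j, σ i < σ j ↔ f i < f j := by
    intro i j
    rw [← hσ i, ← hσ j, OrderEmbedding.lt_iff_lt]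
  have hsub : A.submatrix f id =
      (A.submatrix ((C ∪ K).orderEmbOfFin hU) id).submatrix σ id := by
    ext i j
    simp [hσ]
  rw [hsub, Matrix.det_permute, ← pluck_of_card_eq]
  congr 1
  rw [Equiv.Perm.sign_eq_prod_prod_Iio]
  push_cast
  have key : ∀ j, ∏ i ∈ Iio j, (((if σ i < σ j then 1 else -1 : ℤˣ) : ℤ) : ℝ) =
      ∏ i, if i < j then (if f i < f j then 1 else -1 : ℝ) else 1 := by
    intro j
    rw [← prod_filter]
    refine prod_congr (by ext; simp) fun i _ => ?_
    simp only [hlt]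
    split_ifs <;> simp
  rw [prod_congr rfl fun j _ => key j, Fin.prod_univ_add]
  simp only [Fin.prod_univ_add, hf, Fin.append_left, Fin.append_right, OrderEmbedding.lt_iff_lt]
  have hcast : ∀ i j : Fin p, Fin.castAdd q i < Fin.castAdd q j ↔ i < j := fun _ _ => Iff.rfl
  have hite : ∀ (P : Prop) [Decidable P], (if P then (if P then 1 else -1 : ℝ) else 1) = 1 :=
    fun P _ => by split_ifs <;> rfl
  simp only [castAdd_lt_natAdd, (castAdd_lt_natAdd _ _).asymm, hcast, Fin.natAdd_lt_natAdd_iff,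
    hite, if_true, if_false, prod_const_one, one_mul, mul_one]
  rw [← prod_orderEmbOfFin hK]
  refine prod_congr rfl fun j _ => ?_
  rw [gapSign, ← prod_orderEmbOfFin hC]

theorem det_eq_of_left_rows {p q : ℕ} (M : Matrix (Fin (p + q)) (Fin (p + q)) ℝ)
    (h : ∀ i j, M (Fin.castAdd q i) j = if Fin.castAdd q i = j then 1 else 0) :
    M.det = (M.submatrix (Fin.natAdd p) (Fin.natAdd p)).det := by
  rw [← Matrix.det_submatrix_equiv_self finSumFinEquiv M,
    ← Matrix.fromBlocks_toBlocks (M.submatrix finSumFinEquiv finSumFinEquiv)]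
  have h11 : (M.submatrix finSumFinEquiv finSumFinEquiv).toBlocks₁₁ =
      (1 : Matrix (Fin p) (Fin p) ℝ) := by
    ext i j
    simp [Matrix.toBlocks₁₁, h, Matrix.one_apply]
  have h12 : (M.submatrix finSumFinEquiv finSumFinEquiv).toBlocks₁₂ =
      (0 : Matrix (Fin p) (Fin q) ℝ) := by
    ext i j
    simp [Matrix.toBlocks₁₂, h, (castAdd_lt_natAdd i j).ne]
  rw [h11, h12, Matrix.det_fromBlocks_zero₁₂, Matrix.det_one, one_mul]
  rfl

/-- If the rows of `A` indexed by `C` are the first standard basis vectors, then the Plücker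
coordinates of `A` containing `C` are those of a submatrix with rescaled rows. -/
theorem pluck_union_map {N M p q : ℕ} (A : Matrix (Fin N) (Fin (p + q)) ℝ) {C : Finset (Fin N)}
    (hC : C.card = p) (φ : Fin M ↪o Fin N) (hφ : ∀ k, φ k ∉ C)
    (hA : ∀ i j, A (C.orderEmbOfFin hC i) j = if Fin.castAdd q i = j then 1 else 0)
    (K : Finset (Fin M)) :
    pluck A (C ∪ K.map φ.toEmbedding) =
      pluck (Matrix.of fun k b => gapSign C (φ k) * A (φ k) (Fin.natAdd p b)) K := by
  have hdisj : Disjoint C (K.map φ.toEmbedding) := by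
    rw [disjoint_right]
    simpa using fun k _ => hφ k
  by_cases hK : K.card = q
  · have hK' : (K.map φ.toEmbedding).card = q := by rw [card_map, hK]
    have hemb : ∀ j, (K.map φ.toEmbedding).orderEmbOfFin hK' j = φ (K.orderEmbOfFin hK j) := by
      intro j
      exact (congrFun (orderEmbOfFin_unique hK' (f := fun j => φ (K.orderEmbOfFin hK j))
        (by simp) (φ.strictMono.comp (K.orderEmbOfFin hK).strictMono)) j).symm
    have h := det_submatrix_append A hC hK' hdisj
    rw [det_eq_of_left_rows _ (by simpa using hA), prod_map] at h
    rw [pluck_of_card_eq _ hK]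
    have hmat : (Matrix.of fun k b => gapSign C (φ k) * A (φ k) (Fin.natAdd p b)).submatrix
        (K.orderEmbOfFin hK) id = Matrix.of fun i j => gapSign C (φ (K.orderEmbOfFin hK i)) *
        ((A.submatrix (Fin.append (C.orderEmbOfFin hC)
          ((K.map φ.toEmbedding).orderEmbOfFin hK')) id).submatrix
          (Fin.natAdd p) (Fin.natAdd p)) i j := by
      ext i j
      simp [hemb]
    rw [hmat, Matrix.det_mul_column, h]
    have hprod : ∏ i, gapSign C (φ (K.orderEmbOfFin hK i)) = ∏ k ∈ K, gapSign C (φ k) :=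
      prod_orderEmbOfFin hK fun k => gapSign C (φ k)
    rw [hprod, ← mul_assoc]
    change _ = (∏ k ∈ K, gapSign C (φ k)) * (∏ k ∈ K, gapSign C (φ k)) * _
    rw [← prod_mul_distrib, prod_eq_one fun k _ => gapSign_mul_self C (φ k), one_mul]
  · rw [pluck_of_card_ne _ hK, pluck_of_card_ne]
    rw [card_union_of_disjoint hdisj, card_map, hC]
    omega

theorem exists_contraction {N M p q : ℕ} (hq : 1 ≤ q) (A : Matrix (Fin N) (Fin (p + q)) ℝ)
    {C : Finset (Fin N)} (hC : C.card = p) (φ : Fin M ↪o Fin N) (hφ : ∀ k, φ k ∉ C) :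
    ∃ B : Matrix (Fin M) (Fin q) ℝ, ∀ K, pluck B K = pluck A (C ∪ K.map φ.toEmbedding) := by
  by_cases hK : ∃ K : Finset (Fin M), pluck A (C ∪ K.map φ.toEmbedding) ≠ 0
  · obtain ⟨K, hne⟩ := hK
    have hdisj : Disjoint C (K.map φ.toEmbedding) := by
      rw [disjoint_right]
      simpa using fun k _ => hφ k
    have hK' : (K.map φ.toEmbedding).card = q := by
      have := card_eq_of_pluck_ne_zero hne
      rw [card_union_of_disjoint hdisj] at this
      omega
    set r := Fin.append (C.orderEmbOfFin hC) ((K.map φ.toEmbedding).orderEmbOfFin hK') with hr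
    have hdet : (A.submatrix r id).det ≠ 0 := by
      rw [det_submatrix_append A hC hK' hdisj]
      exact mul_ne_zero (prod_ne_zero_iff.2 fun k _ =>
        left_ne_zero_of_mul_eq_one (gapSign_mul_self C k)) hne
    let d : Fin (p + q) → ℝ := Function.update 1 (Fin.natAdd p ⟨0, hq⟩) (A.submatrix r id).det
    let G := (A.submatrix r id)⁻¹ * Matrix.diagonal d
    have hG : G.det = 1 := by
      rw [Matrix.det_mul, Matrix.det_diagonal, Matrix.det_nonsing_inv, Ring.inverse_eq_inv']
      simp only [d]
      rw [prod_update_of_mem (mem_univ _)]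
      simp [hdet]
    have hAG : (A * G).submatrix r id = Matrix.diagonal d := by
      have : (A * G).submatrix r id = A.submatrix r id * G := rfl
      rw [this, Matrix.mul_nonsing_inv_cancel_left _ _ hdet.isUnit]
    refine ⟨_, fun K => (pluck_union_map (A * G) hC φ hφ (fun i j => ?_) K).symm.trans ?_⟩
    · have h := congrFun (congrFun hAG (Fin.castAdd q i)) j
      rw [Matrix.submatrix_apply, hr, Fin.append_left, id, Matrix.diagonal_apply] at h
      have hd : d (Fin.castAdd q i) = 1 :=
        Function.update_of_ne (castAdd_lt_natAdd i _).ne _ _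
      rw [h, hd]
    · rw [pluck_mul, hG, mul_one]
  · push Not at hK
    exact ⟨0, fun K => by rw [pluck_zero hq, hK]⟩

theorem exists_extension {N M p q : ℕ} (B : Matrix (Fin M) (Fin q) ℝ)
    {C : Finset (Fin N)} (hC : C.card = p) (φ : Fin M ↪o Fin N) (hφ : ∀ k, φ k ∉ C) :
    ∃ A : Matrix (Fin N) (Fin (p + q)) ℝ,
      (∀ K, pluck A (C ∪ K.map φ.toEmbedding) = pluck B K) ∧
        ∀ I, pluck A I ≠ 0 → ∃ K : Finset (Fin M), I = C ∪ K.map φ.toEmbedding := by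
  let A : Matrix (Fin N) (Fin (p + q)) ℝ := Matrix.of fun i =>
    Fin.append (fun a => if C.orderEmbOfFin hC a = i then 1 else 0)
      (fun b => ∑ k, if φ k = i then gapSign C i * B k b else 0)
  have hleft : ∀ i a, A i (Fin.castAdd q a) = if C.orderEmbOfFin hC a = i then 1 else 0 :=
    fun i a => by simp [A]
  have hright : ∀ i b, A i (Fin.natAdd p b) =
      ∑ k, if φ k = i then gapSign C i * B k b else 0 := fun i a => by simp [A]
  have hne : ∀ k a, C.orderEmbOfFin hC a ≠ φ k := fun k a h =>
    hφ k (h ▸ C.orderEmbOfFin_mem hC a)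
  refine ⟨A, fun K => ?_, fun I hI => ?_⟩
  · rw [pluck_union_map A hC φ hφ]
    · congr 1
      ext k b
      simp [hright, ← mul_assoc, gapSign_mul_self]
    · intro i j
      refine Fin.addCases (fun j => ?_) (fun j => ?_) j
      · simp [hleft, eq_comm]
      · rw [hright, if_neg (castAdd_lt_natAdd i j).ne]
        exact sum_eq_zero fun k _ => if_neg (hne k i).symm
  · have hcard := card_eq_of_pluck_ne_zero hI
    rw [pluck_of_card_eq A hcard] at hI
    have hCI : C ⊆ I := by
      intro c hc
      by_contra hcI
      have hc' : c ∈ Set.range (C.orderEmbOfFin hC) := by simpa using hc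
      obtain ⟨a, rfl⟩ := hc'
      refine hI (Matrix.det_eq_zero_of_column_eq_zero (Fin.castAdd q a) fun i => ?_)
      rw [Matrix.submatrix_apply, id, hleft, if_neg]
      intro h
      exact hcI (h ▸ I.orderEmbOfFin_mem hcard i)
    refine ⟨univ.filter fun k => φ k ∈ I, ?_⟩
    ext x
    simp only [mem_union, mem_map, mem_filter, mem_univ, true_and]
    constructor
    · intro hx
      by_contra! hcon
      obtain ⟨hxC, hxφ⟩ := hcon
      have hx' : x ∈ Set.range (I.orderEmbOfFin hcard) := by simpa using hx
      obtain ⟨i, rfl⟩ := hx'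
      refine hI (Matrix.det_eq_zero_of_row_eq_zero i fun j => ?_)
      rw [Matrix.submatrix_apply, id]
      refine Fin.addCases (fun j => ?_) (fun j => ?_) j
      · rw [hleft, if_neg]
        intro h
        exact hxC (h ▸ C.orderEmbOfFin_mem hC j)
      · rw [hright]
        exact sum_eq_zero fun k _ => if_neg fun h => hxφ k (show φ.toEmbedding k ∈ I by rwa [h]) h
    · rintro (hx | ⟨k, hk, rfl⟩)
      exacts [hCI hx, hk]

/-- Simplification of a homogeneous quadratic Plücker expression: the inequality over
`Gr^{≥0}(m, m+n)` is valid iff the inequality obtained by transporting the symmetric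
differences `I_α ∖ J_α`, `J_α ∖ I_α` through the order-preserving bijection
`Φ : (I_α ∖ J_α) ∪ (J_α ∖ I_α) → {1, …, 2η}` is valid over `Gr^{≥0}(η, 2η)`.
Here `Φ` is realized by `D.orderIsoOfFin`, and `K_α = Φ(I_α ∖ J_α)` (resp.
`L_α = Φ(J_α ∖ I_α)`) is realized as the preimage filter. -/
theorem stmt_1 (m n η : ℕ) (hm : 1 ≤ m) (hmn : m ≤ n) (hη : 1 ≤ η)
    {ι : Type} (S : Finset ι) (I J : ι → Finset (Fin (m + n))) (c : ι → ℝ)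
    (hcard : ∀ α ∈ S, (I α).card = m ∧ (J α).card = m)
    (hmulti : ∀ α ∈ S, ∀ β ∈ S, (I α).val + (J α).val = (I β).val + (J β).val)
    (D : Finset (Fin (m + n))) (hD : D.card = 2 * η)
    (hDeq : ∀ α ∈ S, (I α \ J α) ∪ (J α \ I α) = D)
    (hηeq : ∀ α ∈ S, (I α \ J α).card = η) :
    (∀ A : Matrix (Fin (m + n)) (Fin m) ℝ, A.rank = m →
        (∀ K : Finset (Fin (m + n)), 0 ≤ pluck A K) →
        0 ≤ ∑ α ∈ S, c α * pluck A (I α) * pluck A (J α)) ↔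
      (∀ B : Matrix (Fin (2 * η)) (Fin η) ℝ, B.rank = η →
        (∀ K : Finset (Fin (2 * η)), 0 ≤ pluck B K) →
        0 ≤ ∑ α ∈ S,
            c α *
              pluck B (Finset.univ.filter
                (fun k : Fin (2 * η) => ((D.orderIsoOfFin hD) k : Fin (m + n)) ∈ I α \ J α)) *
              pluck B (Finset.univ.filter
                (fun k : Fin (2 * η) => ((D.orderIsoOfFin hD) k : Fin (m + n)) ∈ J α \ I α))) := by
  rcases S.eq_empty_or_nonempty with rfl | ⟨α₀, hα₀⟩
  · simp
  set C := I α₀ ∩ J α₀ with hCdef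
  have hInter : ∀ α ∈ S, I α ∩ J α = C := by
    intro α hα
    ext x
    have h := congrArg (Multiset.count x) (hmulti α hα α₀ hα₀)
    simp only [Multiset.count_add, Multiset.count_eq_of_nodup (Finset.nodup _), mem_val] at h
    simp only [hCdef, mem_inter]
    grind
  have hCm : C.card + η = m := by
    have h1 := card_sdiff_add_card_inter (I α₀) (J α₀)
    rwa [hηeq α₀ hα₀, (hcard α₀ hα₀).1, add_comm] at h1
  generalize hp : C.card = p at hCm
  subst hCm
  let φ : Fin (2 * η) ↪o Fin (p + η + n) := D.orderEmbOfFin hD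
  have hφD : ∀ x, x ∈ D ↔ ∃ k, φ k = x := fun x => by
    rw [← mem_coe, ← range_orderEmbOfFin D hD]
    rfl
  have hφC : ∀ k, φ k ∉ C := by
    intro k hk
    have hkD := (hφD _).2 ⟨k, rfl⟩
    rw [← hDeq α₀ hα₀] at hkD
    rw [hCdef] at hk
    simp only [mem_union, mem_sdiff, mem_inter] at hkD hk
    tauto
  have hunion : ∀ X : Finset (Fin (p + η + n)), X ⊆ D →
      C ∪ (univ.filter fun k => φ k ∈ X).map φ.toEmbedding = C ∪ X := by
    intro X hX
    congr 1
    ext x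
    simp only [mem_map, mem_filter, mem_univ, true_and]
    constructor
    · rintro ⟨k, hk, rfl⟩
      exact hk
    · intro hx
      obtain ⟨k, rfl⟩ := (hφD x).1 (hX hx)
      exact ⟨k, hx, rfl⟩
  have hI : ∀ α ∈ S, C ∪ (univ.filter fun k => φ k ∈ I α \ J α).map φ.toEmbedding = I α := by
    intro α hα
    rw [hunion _ (hDeq α hα ▸ subset_union_left), ← hInter α hα, union_comm, sdiff_union_inter]
  have hJ : ∀ α ∈ S, C ∪ (univ.filter fun k => φ k ∈ J α \ I α).map φ.toEmbedding = J α := by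
    intro α hα
    rw [hunion _ (hDeq α hα ▸ subset_union_right), ← hInter α hα, union_comm, inter_comm,
      sdiff_union_inter]
  have hsum : ∀ (A : Matrix (Fin (p + η + n)) (Fin (p + η)) ℝ)
      (B : Matrix (Fin (2 * η)) (Fin η) ℝ),
      (∀ K, pluck A (C ∪ K.map φ.toEmbedding) = pluck B K) →
      ∑ α ∈ S, c α * pluck A (I α) * pluck A (J α) =
        ∑ α ∈ S, c α * pluck B (univ.filter fun k => φ k ∈ I α \ J α) *
          pluck B (univ.filter fun k => φ k ∈ J α \ I α) := by
    intro A B hAB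
    refine sum_congr rfl fun α hα => ?_
    rw [← hAB, ← hAB, hI α hα, hJ α hα]
  constructor
  · intro h B _ hB
    obtain ⟨A, hAB, hA⟩ := exists_extension B hp φ hφC
    refine le_of_le_of_eq ?_ (hsum A B hAB)
    by_cases hne : ∃ K, pluck A K ≠ 0
    · obtain ⟨K, hK⟩ := hne
      refine h A (rank_eq_of_pluck_ne_zero hK) fun L => ?_
      by_cases hL : pluck A L = 0
      · exact hL.ge
      · obtain ⟨L', rfl⟩ := hA L hL
        exact hAB L' ▸ hB L'
    · push Not at hne
      simp [hne]
  · intro h A _ hA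
    obtain ⟨B, hAB⟩ := exists_contraction hη A hp φ hφC
    rw [hsum A B fun K => (hAB K).symm]
    by_cases hne : ∃ K, pluck B K ≠ 0
    · obtain ⟨K, hK⟩ := hne
      exact h B (rank_eq_of_pluck_ne_zero hK) fun L => hAB L ▸ hA _
    · push Not at hne
      simp [hne]
end

section
/- Let 1 ≤ m ≤ n be integers and let 𝒜 be a full-rank (m+n)×m real matrix all of whose Plücker coordinates are nonnegative. Then the positroid ℳ_𝒜 := {I ⊆ {1,…,m+n} : |I| = m and Δ_I(𝒜) ≠ 0} is closed under the coordinatewise operations min and max: if I, J ∈ ℳ_𝒜 then min(I,J) ∈ ℳ_𝒜 and max(I,J) ∈ ℳ_𝒜 (so that (ℳ_𝒜, min, max) is a distributive lattice). -/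
open Finset

/-- Coordinatewise minimum `min(I,J) = {min(i_k, j_k)}` of two `m`-element sets,
listed in increasing order. -/
def cmin {α : Type*} [LinearOrder α] {m : ℕ} (I J : Finset α)
    (hI : I.card = m) (hJ : J.card = m) : Finset α :=
  Finset.image (fun k : Fin m => min ((I.orderIsoOfFin hI) k : α) ((J.orderIsoOfFin hJ) k : α))
    Finset.univ

/-- Coordinatewise maximum `max(I,J) = {max(i_k, j_k)}` of two `m`-element sets,
listed in increasing order. -/
def cmax {α : Type*} [LinearOrder α] {m : ℕ} (I J : Finset α)
    (hI : I.card = m) (hJ : J.card = m) : Finset α :=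
  Finset.image (fun k : Fin m => max ((I.orderIsoOfFin hI) k : α) ((J.orderIsoOfFin hJ) k : α))
    Finset.univ

open scoped Matrix

/-- Jacobi's identity for replacing two rows of a square matrix. -/
theorem Matrix.det_mul_det_updateRow_updateRow {ι R : Type*} [Fintype ι] [DecidableEq ι]
    [CommRing R] (M : Matrix ι ι R) {k l : ι} (hkl : k ≠ l) (p q : ι → R) :
    M.det * ((M.updateRow k p).updateRow l q).det =
      (M.updateRow k p).det * (M.updateRow l q).det -
        (M.updateRow l p).det * (M.updateRow k q).det := by
  set N := M.updateRow l q with hN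
  have hp : M.det • p = ∑ i, (M.updateRow i p).det • M i := by
    have h := Matrix.mulVec_cramer Mᵀ p
    rw [Matrix.det_transpose] at h
    rw [← h]
    ext j
    simp [Matrix.mulVec, dotProduct, Matrix.cramer_transpose_apply, mul_comm]
  have hsum : ∑ i, (M.updateRow i p).det • M i =
      ∑ i, (M.updateRow i p).det • N i + (M.updateRow l p).det • (M l - q) := by
    rw [← sub_eq_iff_eq_add', ← Finset.sum_sub_distrib, Finset.sum_eq_single l]
    · simp [hN, smul_sub]
    · intro i _ hi
      simp [hN, hi]
    · simp
  have hswap : (N.updateRow k (M l)).det = - (M.updateRow k q).det := by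
    have h := Matrix.det_permute (Equiv.swap k l) (M.updateRow k q)
    rw [Equiv.Perm.sign_swap hkl] at h
    have e : (M.updateRow k q).submatrix (Equiv.swap k l) id = N.updateRow k (M l) := by
      ext i j
      rcases eq_or_ne i k with rfl | hik
      · simp [Matrix.updateRow_apply, hkl.symm]
      · rcases eq_or_ne i l with rfl | hil
        · simp [Matrix.updateRow_apply, hkl.symm, hN]
        · simp [Matrix.updateRow_apply, hN, Equiv.swap_apply_of_ne_of_ne hik hil, hik, hil]
    rw [← e, h]
    simp
  have hzero : (N.updateRow k q).det = 0 :=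
    Matrix.det_zero_of_row_eq hkl (by simp [hN, hkl.symm])
  rw [Matrix.updateRow_comm M hkl, ← Matrix.det_updateRow_smul, hp, hsum,
    Matrix.det_updateRow_add, Matrix.det_updateRow_sum, Matrix.det_updateRow_smul, sub_eq_add_neg,
    Matrix.det_updateRow_add, hswap, ← neg_one_smul R q, Matrix.det_updateRow_smul, hzero]
  simp only [smul_eq_mul]
  ring

/-- The determinant of the square matrix whose rows are the rows `f 0, f 1, …` of `A`. -/
noncomputable def rowMinor {α : Type*} {m : ℕ} (A : Matrix α (Fin m) ℝ) (f : Fin m → α) : ℝ :=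
  (A.submatrix f id).det

section RowMinor

variable {α : Type*} {m : ℕ} (A : Matrix α (Fin m) ℝ)

theorem submatrix_update (f : Fin m → α) (k : Fin m) (x : α) :
    A.submatrix (Function.update f k x) id = (A.submatrix f id).updateRow k (A x) := by
  ext i j
  rcases eq_or_ne i k with rfl | h <;> simp [Matrix.updateRow_apply, *]

theorem rowMinor_comp_perm (f : Fin m → α) (σ : Equiv.Perm (Fin m)) :
    rowMinor A (f ∘ σ) = Equiv.Perm.sign σ * rowMinor A f :=
  Matrix.det_permute σ (A.submatrix f id)

/-- The three-term Plücker relation. -/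
theorem rowMinor_three_term (f : Fin m → α) {k l : Fin m} (hkl : k ≠ l) (x y : α) :
    rowMinor A f * rowMinor A (Function.update (Function.update f k x) l y) =
      rowMinor A (Function.update f k x) * rowMinor A (Function.update f l y) -
        rowMinor A (Function.update f l x) * rowMinor A (Function.update f k y) := by
  simp only [rowMinor, submatrix_update]
  exact Matrix.det_mul_det_updateRow_updateRow _ hkl _ _

end RowMinor

theorem Fin.val_cycleIcc {m : ℕ} {i j : Fin m} (hij : i ≤ j) (x : Fin m) :
    ((Fin.cycleIcc i j x : Fin m) : ℕ) =
      if (x : ℕ) < i ∨ (j : ℕ) < x then (x : ℕ) else if (x : ℕ) = j then (i : ℕ) else x + 1 := by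
  have : NeZero m := ⟨by have := x.isLt; omega⟩
  by_cases h1 : x < i
  · rw [Fin.cycleIcc_of_lt h1]
    simp [Fin.lt_def.1 h1]
  by_cases h2 : j < x
  · rw [Fin.cycleIcc_of_gt h2]
    simp [Fin.lt_def.1 h2]
  rcases eq_or_ne x j with rfl | h3
  · rw [Fin.cycleIcc_of_last hij]
    rw [if_neg (by omega), if_pos rfl]
  · have h4 : x < j := lt_of_le_of_ne (not_lt.1 h2) h3
    rw [Fin.cycleIcc_of_ge_of_lt (not_lt.1 h1) h4, Fin.val_add_one_of_lt' (by omega)]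
    rw [if_neg (by omega), if_neg (by omega)]

/-- Nonnegativity of the correction term in the three-term Plücker relation. -/
theorem rowMinor_update_mul_rowMinor_update_nonneg {N m : ℕ} (A : Matrix (Fin N) (Fin m) ℝ)
    (hA : ∀ f : Fin m → Fin N, StrictMono f → 0 ≤ rowMinor A f)
    {f g : Fin m → Fin N} (hf : StrictMono f) (hg : StrictMono g) {k l : Fin m} (hkl : k < l)
    (hk : g k < f k) (hl : f l < g l) (hne : ∀ j, j ≠ k → j ≠ l → f j = g j) :
    0 ≤ rowMinor A (Function.update g l (f k)) * rowMinor A (Function.update g k (f l)) := by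
  have hfkl := hf hkl
  obtain ⟨k1, hk1⟩ : ∃ k1 : Fin m, (k1 : ℕ) = k + 1 := ⟨⟨k + 1, by omega⟩, rfl⟩
  obtain ⟨l1, hl1⟩ : ∃ l1 : Fin m, (l1 : ℕ) + 1 = l := ⟨⟨l - 1, by omega⟩, by simp; omega⟩
  have hkl1 : k1 ≤ l := by omega
  have hkl2 : k ≤ l1 := by omega
  have hu : StrictMono (Function.update g l (f k) ∘ ⇑(Fin.cycleIcc k1 l)⁻¹) := by
    intro x y hxy
    obtain ⟨x, rfl⟩ := (Fin.cycleIcc k1 l).surjective x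
    obtain ⟨y, rfl⟩ := (Fin.cycleIcc k1 l).surjective y
    rw [Fin.lt_def, Fin.val_cycleIcc hkl1, Fin.val_cycleIcc hkl1] at hxy
    simp only [Function.comp_apply, Equiv.Perm.inv_def, Equiv.symm_apply_apply]
    rcases eq_or_ne x l with rfl | hx
    · rcases eq_or_ne y x with rfl | hy
      · simp at hxy
      · rw [Function.update_self, Function.update_of_ne hy]
        by_cases h : y = k
        · subst h; exfalso; split_ifs at hxy <;> omega
        rw [← hne y h hy]
        apply hf
        split_ifs at hxy <;> omega
    · rcases eq_or_ne y l with rfl | hy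
      · rw [Function.update_self, Function.update_of_ne hx]
        by_cases h : x = k
        · subst h; exact hk
        rw [← hne x h hx]
        apply hf
        split_ifs at hxy <;> omega
      · rw [Function.update_of_ne hx, Function.update_of_ne hy]
        apply hg
        split_ifs at hxy <;> omega
  have hv : StrictMono (Function.update g k (f l) ∘ Fin.cycleIcc k l1) := by
    intro x y hxy
    have ex := Fin.val_cycleIcc hkl2 x
    have ey := Fin.val_cycleIcc hkl2 y
    simp only [Function.comp_apply]
    generalize Fin.cycleIcc k l1 x = x' at *
    generalize Fin.cycleIcc k l1 y = y' at *
    rcases eq_or_ne x' k with rfl | hx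
    · rcases eq_or_ne y' x' with rfl | hy
      · exfalso; split_ifs at ex ey <;> omega
      · rw [Function.update_self, Function.update_of_ne hy]
        by_cases h : y' = l
        · subst h; exact hl
        rw [← hne y' hy h]
        apply hf
        split_ifs at ex ey <;> omega
    · rcases eq_or_ne y' k with rfl | hy
      · rw [Function.update_self, Function.update_of_ne hx]
        by_cases h : x' = l
        · subst h; exfalso; split_ifs at ex ey <;> omega
        rw [← hne x' hx h]
        apply hf
        split_ifs at ex ey <;> omega
      · rw [Function.update_of_ne hx, Function.update_of_ne hy]
        apply hg
        split_ifs at ex ey <;> omega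
  have h1 := hA _ hu
  have h2 := hA _ hv
  rw [rowMinor_comp_perm, Equiv.Perm.sign_inv, Fin.sign_cycleIcc_of_le hkl1] at h1
  rw [rowMinor_comp_perm, Fin.sign_cycleIcc_of_le hkl2,
    show (l1 : ℕ) - k = l - k1 by omega] at h2
  have h3 := mul_nonneg h1 h2
  rcases neg_one_pow_eq_or ℤˣ ((l : ℕ) - k1) with h | h <;> rw [h] at h3 <;> simpa using h3

theorem rowMinor_mul_le_of_differ_two {N m : ℕ} (A : Matrix (Fin N) (Fin m) ℝ)
    (hA : ∀ f : Fin m → Fin N, StrictMono f → 0 ≤ rowMinor A f)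
    {f g : Fin m → Fin N} (hf : StrictMono f) (hg : StrictMono g) {k l : Fin m} (hkl : k < l)
    (hk : g k < f k) (hl : f l < g l) (hne : ∀ j, j ≠ k → j ≠ l → f j = g j) :
    rowMinor A f * rowMinor A g ≤ rowMinor A (f ⊓ g) * rowMinor A (f ⊔ g) := by
  have h := rowMinor_three_term A g hkl.ne (f k) (f l)
  have h' := rowMinor_update_mul_rowMinor_update_nonneg A hA hf hg hkl hk hl hne
  have e1 : Function.update (Function.update g k (f k)) l (f l) = f := by
    ext j
    rcases eq_or_ne j l with rfl | h1
    · simp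
    rcases eq_or_ne j k with rfl | h2
    · simp [h1]
    simp [h1, h2, hne j h2 h1]
  have e2 : Function.update g k (f k) = f ⊔ g := by
    ext j
    rcases eq_or_ne j k with rfl | h2
    · simp [hk.le]
    rcases eq_or_ne j l with rfl | h1
    · simp [h2, hl.le]
    simp [h2, hne j h2 h1]
  have e3 : Function.update g l (f l) = f ⊓ g := by
    ext j
    rcases eq_or_ne j l with rfl | h1
    · simp [hl.le]
    rcases eq_or_ne j k with rfl | h2
    · simp [h1, hk.le]
    simp [h1, hne j h2 h1]
  rw [e1, e2, e3] at h
  linarith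

theorem StrictMono.inf {α β : Type*} [Preorder α] [LinearOrder β] {f g : α → β}
    (hf : StrictMono f) (hg : StrictMono g) : StrictMono (f ⊓ g) :=
  fun _ _ h ↦ min_lt_min (hf h) (hg h)

theorem StrictMono.sup {α β : Type*} [Preorder α] [LinearOrder β] {f g : α → β}
    (hf : StrictMono f) (hg : StrictMono g) : StrictMono (f ⊔ g) :=
  fun _ _ h ↦ max_lt_max (hf h) (hg h)

theorem StrictMono.update_of_lt {N m : ℕ} {f g : Fin m → Fin N} (hf : StrictMono f)
    (hg : StrictMono g) {k : Fin m} {x : Fin N} (hgx : g k ≤ x) (hxf : x < f k)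
    (hmin : ∀ j < k, f j ≤ g j) : StrictMono (Function.update f k x) := by
  intro i j hij
  rcases eq_or_ne i k with rfl | hi
  · rw [Function.update_self, Function.update_of_ne hij.ne']
    exact hxf.trans (hf hij)
  · rw [Function.update_of_ne hi]
    rcases eq_or_ne j k with rfl | hj
    · rw [Function.update_self]
      exact ((hmin i hij).trans_lt (hg hij)).trans_le hgx
    · rw [Function.update_of_ne hj]
      exact hf hij

/-- Log-supermodularity of the maximal minors when all of them are positive. -/
theorem rowMinor_mul_le_of_pos {N m : ℕ} (A : Matrix (Fin N) (Fin m) ℝ)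
    (hA : ∀ f : Fin m → Fin N, StrictMono f → 0 < rowMinor A f)
    {f g : Fin m → Fin N} (hf : StrictMono f) (hg : StrictMono g) :
    rowMinor A f * rowMinor A g ≤ rowMinor A (f ⊓ g) * rowMinor A (f ⊔ g) := by
  induction hd : #{k | f k ≠ g k} using Nat.strong_induction_on generalizing f g with
  | _ d ih =>
  subst hd
  wlog hFG : #{k | f k < g k} ≤ #{k | g k < f k} generalizing f g
  · rw [mul_comm, inf_comm, sup_comm]
    refine this hg hf (fun d hd f' g' hf' hg' h ↦ ih d ?_ hf' hg' h) (le_of_not_ge hFG)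
    simpa only [ne_comm] using hd
  by_cases hle : f ≤ g
  · rw [inf_eq_left.2 hle, sup_eq_right.2 hle]
  by_cases hge : g ≤ f
  · rw [inf_eq_right.2 hge, sup_eq_left.2 hge, mul_comm]
  obtain ⟨k, hk, hmin⟩ : ∃ k, g k < f k ∧ ∀ j < k, f j ≤ g j := by
    have hne : ({k | g k < f k} : Finset (Fin m)).Nonempty := by
      rw [Pi.le_def, not_forall] at hle
      obtain ⟨k, hk⟩ := hle
      exact ⟨k, by simpa using hk⟩
    refine ⟨_, (Finset.mem_filter.1 (Finset.min'_mem _ hne)).2, fun j hj ↦ ?_⟩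
    by_contra! h
    exact hj.not_ge (Finset.min'_le _ _ (by simpa using h))
  obtain ⟨l, hl⟩ : ∃ l, f l < g l := by
    rw [Pi.le_def, not_forall] at hge
    obtain ⟨l, hl⟩ := hge
    exact ⟨l, not_le.1 hl⟩
  by_cases hk' : ∃ k', k' ≠ k ∧ g k' < f k'
  · obtain ⟨k', hkk', hk'⟩ := hk'
    set f' := Function.update f k (g k) with hf'
    have hf'mono : StrictMono f' := hf.update_of_lt hg le_rfl hk hmin
    have hne' : ∀ j, j ≠ k → f' j = f j := fun j hj ↦ by simp [hf', hj]
    have hfk' : f' k = g k := by simp [hf']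
    have hf'le : f' ≤ f := fun j ↦ by
      rcases eq_or_ne j k with rfl | hj
      · rw [hfk']; exact hk.le
      · rw [hne' j hj]
    have hgmono : StrictMono (f' ⊔ g) := hf'mono.sup hg
    have h1 := ih _ (Finset.card_lt_card (Finset.ssubset_iff_of_subset
      (fun j ↦ by
        rcases eq_or_ne j k with rfl | hj
        · simp [hfk']
        · simp [hne' j hj]) |>.2 ⟨k, by simp [hk.ne'], by simp [hfk']⟩)) hf'mono hg rfl
    have h2 := ih _ (Finset.card_lt_card (Finset.ssubset_iff_of_subset
      (fun j ↦ by
        rcases eq_or_ne j k with rfl | hj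
        · simp [hk.ne']
        · simp only [Finset.mem_filter, Finset.mem_univ, true_and, Pi.sup_apply, hne' j hj]
          intro h h'
          simp [h'] at h) |>.2 ⟨k', by simp [hk'.ne'], by simp [hne' k' hkk', hk'.le]⟩))
        hf hgmono rfl
    have e1 : f' ⊓ g = f ⊓ g := by
      ext j : 1
      rcases eq_or_ne j k with rfl | hj
      · simp [hfk', hk.le]
      · simp [hne' j hj]
    have e2 : f ⊓ (f' ⊔ g) = f' := by
      ext j : 1
      rcases eq_or_ne j k with rfl | hj
      · simp [hfk', hk.le]
      · simp [hne' j hj]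
    have e3 : f ⊔ (f' ⊔ g) = f ⊔ g := by rw [← sup_assoc, sup_eq_left.2 hf'le]
    rw [e1] at h1
    rw [e2, e3] at h2
    have p1 := hA _ hf'mono
    have p2 := hA _ hgmono
    have h3 := mul_le_mul h1 h2 (mul_nonneg (hA _ hf).le p2.le)
      (mul_nonneg (hA _ (hf.inf hg)).le p2.le)
    refine le_of_mul_le_mul_right ?_ (mul_pos p1 p2)
    linarith
  · push Not at hk'
    have hF : #{k | g k < f k} ≤ 1 := by
      refine (Finset.card_le_card (t := {k}) fun j hj ↦ ?_).trans (by simp)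
      by_contra h
      exact (hk' j (by simpa using h)).not_gt (by simpa using hj)
    have hG := Finset.card_le_one.1 (hFG.trans hF)
    have hne : ∀ j, j ≠ k → j ≠ l → f j = g j := by
      intro j hjk hjl
      refine le_antisymm (hk' j hjk) (le_of_not_gt fun h ↦ hjl ?_)
      exact hG j (by simpa using h) l (by simpa using hl)
    have hA' := fun f hf ↦ (hA f hf).le
    rcases lt_trichotomy k l with h | rfl | h
    · exact rowMinor_mul_le_of_differ_two A hA' hf hg h hk hl hne
    · exact absurd hk hl.not_gt
    · rw [mul_comm, inf_comm, sup_comm]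
      exact rowMinor_mul_le_of_differ_two A hA' hg hf h hl hk fun j h1 h2 ↦ (hne j h2 h1).symm

section AddRow

variable {α : Type*} [DecidableEq α] {m : ℕ} (A : Matrix α (Fin m) ℝ)

theorem rowMinor_updateRow_of_notMem (i : α) (v : Fin m → ℝ) {f : Fin m → α}
    (hf : ∀ k, f k ≠ i) : rowMinor (A.updateRow i v) f = rowMinor A f := by
  unfold rowMinor
  congr 1
  ext k j
  simp [Matrix.updateRow_apply, hf k]

theorem rowMinor_updateRow_add_smul (i j : α) (t : ℝ) {f : Fin m → α}
    (hf : Function.Injective f) {k : Fin m} (hk : f k = i) :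
    rowMinor (A.updateRow i (A i + t • A j)) f =
      rowMinor A f + t * rowMinor A (Function.update f k j) := by
  have e : (A.updateRow i (A i + t • A j)).submatrix f id =
      (A.submatrix f id).updateRow k (A i + t • A j) := by
    ext a b
    simp [Matrix.updateRow_apply, ← hk, hf.eq_iff]
  have e' : A i = A.submatrix f id k := by ext; simp [hk]
  rw [rowMinor, e, Matrix.det_updateRow_add, Matrix.det_updateRow_smul, rowMinor, rowMinor,
    submatrix_update, e', Matrix.updateRow_eq_self]

theorem continuous_rowMinor_updateRow_add_smul (i j : α) (f : Fin m → α) :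
    Continuous fun t : ℝ ↦ rowMinor (A.updateRow i (A i + t • A j)) f := by
  unfold rowMinor
  refine Continuous.matrix_det (continuous_matrix fun a b ↦ ?_)
  simp only [Matrix.submatrix_apply, Matrix.updateRow_apply, Pi.add_apply, Pi.smul_apply]
  split_ifs <;> fun_prop

end AddRow

theorem StrictMono.update_adjacent {N m : ℕ} {f : Fin m → Fin N} (hf : StrictMono f)
    {k : Fin m} {j : Fin N} (hj : (f k : ℕ) + 1 = j ∨ (j : ℕ) + 1 = f k) (hjf : ∀ l, f l ≠ j) :
    StrictMono (Function.update f k j) := by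
  intro a b hab
  have h := hf hab
  have ha := hjf a
  have hb := hjf b
  rcases eq_or_ne a k with rfl | hak
  · rw [Function.update_self, Function.update_of_ne hab.ne']
    omega
  · rw [Function.update_of_ne hak]
    rcases eq_or_ne b k with rfl | hbk
    · rw [Function.update_self]
      omega
    · rwa [Function.update_of_ne hbk]

/-- Adding a nonnegative multiple of an adjacent row does not decrease the maximal minors of a
totally nonnegative matrix. -/
theorem rowMinor_le_rowMinor_updateRow {N m : ℕ} (A : Matrix (Fin N) (Fin m) ℝ)
    (hA : ∀ f : Fin m → Fin N, StrictMono f → 0 ≤ rowMinor A f) {i j : Fin N}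
    (hij : (i : ℕ) + 1 = j ∨ (j : ℕ) + 1 = i) {t : ℝ} (ht : 0 ≤ t) {f : Fin m → Fin N}
    (hf : StrictMono f) :
    rowMinor A f ≤ rowMinor (A.updateRow i (A i + t • A j)) f := by
  by_cases hi : ∃ k, f k = i
  · obtain ⟨k, rfl⟩ := hi
    rw [rowMinor_updateRow_add_smul A _ j t hf.injective rfl]
    suffices 0 ≤ rowMinor A (Function.update f k j) from
      le_add_of_nonneg_right (mul_nonneg ht this)
    by_cases hj : ∃ l, f l = j
    · obtain ⟨l, rfl⟩ := hj
      have hkl : k ≠ l := by rintro rfl; omega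
      refine (Matrix.det_zero_of_row_eq hkl ?_).ge
      ext
      simp [hkl.symm]
    · push Not at hj
      exact hA _ (hf.update_adjacent hij hj)
  · push Not at hi
    rw [rowMinor_updateRow_of_notMem A _ _ hi]

/-- A property of strictly increasing sequences that is invariant under moving one entry by one
step is constant. -/
theorem strictMono_connected {N m : ℕ} (P : (Fin m → Fin N) → Prop)
    (hP : ∀ (f : Fin m → Fin N) (k : Fin m) (j : Fin N), StrictMono f →
      StrictMono (Function.update f k j) → (j : ℕ) + 1 = f k → (P f ↔ P (Function.update f k j)))
    {f g : Fin m → Fin N} (hf : StrictMono f) (hg : StrictMono g) : P f ↔ P g := by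
  have key : ∀ (d : ℕ) (f g : Fin m → Fin N), StrictMono f → StrictMono g → g ≤ f →
      ∑ k, (f k : ℕ) = d → (P f ↔ P g) := by
    intro d
    induction d using Nat.strong_induction_on with
    | _ d ih =>
    rintro f g hf hg hgf rfl
    by_cases hfg : f ≤ g
    · rw [le_antisymm hfg hgf]
    have hne : ({k | g k < f k} : Finset (Fin m)).Nonempty := by
      rw [Pi.le_def, not_forall] at hfg
      obtain ⟨k, hk⟩ := hfg
      exact ⟨k, by simpa using hk⟩
    obtain ⟨k, hk, hmin⟩ : ∃ k, g k < f k ∧ ∀ j < k, f j ≤ g j := by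
      refine ⟨_, (Finset.mem_filter.1 (Finset.min'_mem _ hne)).2, fun j hj ↦ ?_⟩
      by_contra! h
      exact hj.not_ge (Finset.min'_le _ _ (by simpa using h))
    obtain ⟨x, hx⟩ : ∃ x : Fin N, (x : ℕ) + 1 = f k := ⟨⟨f k - 1, by omega⟩, by simp; omega⟩
    have hmono : StrictMono (Function.update f k x) :=
      hf.update_of_lt hg (by omega) (by omega) hmin
    rw [hP f k x hf hmono hx]
    refine ih _ ?_ _ _ hmono hg (fun j ↦ ?_) rfl
    · refine Finset.sum_lt_sum (fun j _ ↦ ?_) ⟨k, Finset.mem_univ _, ?_⟩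
      · rcases eq_or_ne j k with rfl | hj
        · rw [Function.update_self]; omega
        · rw [Function.update_of_ne hj]
      · rw [Function.update_self]; omega
    · rcases eq_or_ne j k with rfl | hj
      · rw [Function.update_self]
        have := Fin.lt_def.1 hk
        exact Fin.le_def.2 (by omega)
      · rw [Function.update_of_ne hj]; exact hgf j
  rw [key _ f (f ⊓ g) hf (hf.inf hg) inf_le_left rfl,
    key _ g (f ⊓ g) hg (hf.inf hg) inf_le_right rfl]

/-- Log-supermodularity of the maximal minors of a totally nonnegative matrix. -/
theorem rowMinor_mul_le {N m : ℕ} (A : Matrix (Fin N) (Fin m) ℝ)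
    (hA : ∀ f : Fin m → Fin N, StrictMono f → 0 ≤ rowMinor A f)
    {f g : Fin m → Fin N} (hf : StrictMono f) (hg : StrictMono g) :
    rowMinor A f * rowMinor A g ≤ rowMinor A (f ⊓ g) * rowMinor A (f ⊔ g) := by
  classical
  induction hd : #{h : Fin m → Fin N | StrictMono h ∧ rowMinor A h = 0}
    using Nat.strong_induction_on generalizing A with
  | _ d ih =>
  subst hd
  by_cases hf0 : rowMinor A f = 0
  · rw [hf0, zero_mul]
    exact mul_nonneg (hA _ (hf.inf hg)) (hA _ (hf.sup hg))
  by_cases hall : ∀ h : Fin m → Fin N, StrictMono h → rowMinor A h ≠ 0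
  · exact rowMinor_mul_le_of_pos A (fun h hh ↦ (hA h hh).lt_of_ne' (hall h hh)) hf hg
  push Not at hall
  obtain ⟨f₀, hf₀, hzero⟩ := hall
  obtain ⟨h, k, j, hh, hh', hj, h0, h1⟩ : ∃ (h : Fin m → Fin N) (k : Fin m) (j : Fin N),
      StrictMono h ∧ StrictMono (Function.update h k j) ∧
      ((h k : ℕ) + 1 = j ∨ (j : ℕ) + 1 = h k) ∧ rowMinor A h = 0 ∧
      rowMinor A (Function.update h k j) ≠ 0 := by
    by_contra! hcon
    refine hf0 ((strictMono_connected (fun h ↦ rowMinor A h = 0) ?_ hf hf₀).2 hzero)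
    intro h k j hh hh' hj
    refine ⟨hcon h k j hh hh' (Or.inr hj), fun h0 ↦ ?_⟩
    have := hcon (Function.update h k j) k (h k) hh' (by simpa using hh)
      (Or.inl (by simpa using hj)) h0
    simpa using this
  have hstep : ∀ t : ℝ, 0 < t →
      rowMinor (A.updateRow (h k) (A (h k) + t • A j)) f *
        rowMinor (A.updateRow (h k) (A (h k) + t • A j)) g ≤
      rowMinor (A.updateRow (h k) (A (h k) + t • A j)) (f ⊓ g) *
        rowMinor (A.updateRow (h k) (A (h k) + t • A j)) (f ⊔ g) := by
    intro t ht
    have hle := fun f hf ↦ rowMinor_le_rowMinor_updateRow A hA hj ht.le (f := f) hf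
    refine ih _ (Finset.card_lt_card (Finset.ssubset_iff_of_subset (fun p hp ↦ ?_) |>.2
      ⟨h, by simp [hh, h0], ?_⟩)) _ (fun p hp ↦ (hA p hp).trans (hle p hp)) rfl
    · simp only [Finset.mem_filter, Finset.mem_univ, true_and] at hp ⊢
      exact ⟨hp.1, le_antisymm ((hle p hp.1).trans hp.2.le) (hA p hp.1)⟩
    · simp [hh, rowMinor_updateRow_add_smul A _ j t hh.injective rfl, h0, h1, ht.ne']
  have hc := fun f ↦ continuous_rowMinor_updateRow_add_smul A (h k) j f
  have hlim := ContinuousWithinAt.closure_le (s := Set.Ioi (0 : ℝ)) (x := 0) (by simp)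
    ((hc f).mul (hc g)).continuousWithinAt ((hc (f ⊓ g)).mul (hc (f ⊔ g))).continuousWithinAt hstep
  simpa using hlim

theorem pluck_eq_rowMinor {N m : ℕ} (A : Matrix (Fin N) (Fin m) ℝ) {K : Finset (Fin N)}
    {f : Fin m → Fin N} (hf : StrictMono f) (hK : K = Finset.univ.image f) :
    K.card = m ∧ pluck A K = rowMinor A f := by
  have hcard : K.card = m := by
    rw [hK, Finset.card_image_of_injective _ hf.injective, Finset.card_fin]
  refine ⟨hcard, ?_⟩
  have h := Finset.orderEmbOfFin_unique hcard (f := f) (by simp [hK]) hf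
  rw [pluck, dif_pos hcard, rowMinor, h]
  rfl

/-- Each positroid `ℳ_𝒜 = {I : |I| = m, Δ_I(𝒜) ≠ 0}` is closed under the coordinatewise
operations `min` and `max` (hence forms a distributive lattice). -/
theorem stmt_6 (m n : ℕ) (hm : 1 ≤ m) (hmn : m ≤ n)
    (A : Matrix (Fin (m + n)) (Fin m) ℝ) (hrank : A.rank = m)
    (hpos : ∀ K : Finset (Fin (m + n)), 0 ≤ pluck A K)
    (I J : Finset (Fin (m + n))) (hI : I.card = m) (hJ : J.card = m)
    (hInz : pluck A I ≠ 0) (hJnz : pluck A J ≠ 0) :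
    ((cmin I J hI hJ).card = m ∧ pluck A (cmin I J hI hJ) ≠ 0) ∧
      ((cmax I J hI hJ).card = m ∧ pluck A (cmax I J hI hJ) ≠ 0) := by
  have hA : ∀ f : Fin m → Fin (m + n), StrictMono f → 0 ≤ rowMinor A f := fun f hf ↦ by
    rw [← (pluck_eq_rowMinor A hf rfl).2]
    exact hpos _
  have hf := (I.orderEmbOfFin hI).strictMono
  have hg := (J.orderEmbOfFin hJ).strictMono
  rw [(pluck_eq_rowMinor A hf (by simp)).2] at hInz
  rw [(pluck_eq_rowMinor A hg (by simp)).2] at hJnz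
  have hlt := (mul_pos ((hA _ hf).lt_of_ne' hInz) ((hA _ hg).lt_of_ne' hJnz)).trans_le
    (rowMinor_mul_le A hA hf hg)
  obtain ⟨hmin, hmin'⟩ := pluck_eq_rowMinor A (hf.inf hg) (K := cmin I J hI hJ) rfl
  obtain ⟨hmax, hmax'⟩ := pluck_eq_rowMinor A (hf.sup hg) (K := cmax I J hI hJ) rfl
  rw [hmin', hmax']
  exact ⟨⟨hmin, left_ne_zero_of_mul hlt.ne'⟩, ⟨hmax, right_ne_zero_of_mul hlt.ne'⟩⟩
end
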